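/- (Theorem 3.2, sublinear rate in the smooth case.) Let f : ℝⁿ → ℝ be L-smooth and bounded below by f_low. Let c, τ ∈ (0,1), β̄ > 0, u_g > 0, u_p > 0, κ > 0. Let N ≥ 1, let x_0, x_1, …, x_N ∈ ℝⁿ be a finite sequence of iterates, and let S ⊆ {0, …, N−1} be a nonempty set of successful iterations such that: for every i ∈ S there exist β_i ∈ (0, β̄], g_i ∈ ℝⁿ, and p_i ∈ ℝⁿ with p_i ≠ 0 satisfying x_{i+1} = x_i + β_i p_i, ‖∇f(x_i) − g_i‖ ≤ u_g β_i ‖g_i‖, ⟨−g_i, p_i⟩ > κ ‖g_i‖ ‖p_i‖, ‖g_i‖ ≤ u_p ‖p_i‖, f(x_i + β_i p_i) ≤ f(x_i) + c β_i ⟨g_i, p_i⟩, and either β_i = β̄ or f(x_i + (β_i/τ) p_i) − f(x_i) > c (β_i/τ) ⟨g_i, p_i⟩; and for every i ∈ {0, …, N−1} \ S, f(x_{i+1}) ≤ f(x_i). Then min_{0 ≤ i ≤ N−1} ‖∇f(x_i)‖ ≤ (β̄ u_g + 1) · √((f(x_0) − f_low)/M) · 1/√|S|, where M = c · min{ β̄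 κ / u_p, 2 τ κ² (1 − c) / (2 u_g u_p + L) }. -/

import Mathlib

open scoped RealInnerProductSpace

/-- Descent lemma for functions with Lipschitz gradient. -/
theorem descent_aux {n : ℕ}
    (f : EuclideanSpace ℝ (Fin n) → ℝ) (L : ℝ)
    (hdiff : Differentiable ℝ f)
    (hlip : ∀ y z : EuclideanSpace ℝ (Fin n),
      ‖gradient f y - gradient f z‖ ≤ L * ‖y - z‖)
    (x v : EuclideanSpace ℝ (Fin n)) :
    f (x + v) ≤ f x + ⟪gradient f x, v⟫ + L / 2 * ‖v‖ ^ 2 := by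
  have hd : ∀ t : ℝ, HasDerivAt
      (fun t : ℝ => f (x + t • v) - t * ⟪gradient f x, v⟫ - L / 2 * ‖v‖ ^ 2 * t ^ 2)
      (⟪gradient f (x + t • v), v⟫ - ⟪gradient f x, v⟫ - L * ‖v‖ ^ 2 * t) t := by
    intro t
    have h1 : HasDerivAt (fun t : ℝ => x + t • v) v t := by
      simpa using ((hasDerivAt_id t).smul_const v).const_add x
    have h2 := (hdiff (x + t • v)).hasGradientAt.hasFDerivAt.comp_hasDerivAt t h1
    have h3 := (hasDerivAt_id t).mul_const ⟪gradient f x, v⟫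
    have h4 := (hasDerivAt_pow 2 t).const_mul (L / 2 * ‖v‖ ^ 2)
    have h5 := (h2.sub h3).sub h4
    refine h5.congr_deriv ?_
    simp
    ring
  have hanti : AntitoneOn
      (fun t : ℝ => f (x + t • v) - t * ⟪gradient f x, v⟫ - L / 2 * ‖v‖ ^ 2 * t ^ 2)
      (Set.Icc 0 1) := by
    apply antitoneOn_of_deriv_nonpos (convex_Icc 0 1)
    · exact fun t _ => (hd t).continuousAt.continuousWithinAt
    · exact fun t _ => (hd t).differentiableAt.differentiableWithinAt
    · intro t ht
      rw [interior_Icc] at ht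
      rw [(hd t).deriv, ← inner_sub_left]
      have h1 := real_inner_le_norm (gradient f (x + t • v) - gradient f x) v
      have h2 := hlip (x + t • v) x
      rw [add_sub_cancel_left, norm_smul, Real.norm_of_nonneg ht.1.le] at h2
      have h3 := mul_le_mul_of_nonneg_right h2 (norm_nonneg v)
      nlinarith
  have := hanti (Set.left_mem_Icc.mpr zero_le_one) (Set.right_mem_Icc.mpr zero_le_one) zero_le_one
  simp at this ⊢
  linarith

set_option maxHeartbeats 2000000 in
/-- **Theorem 3.2.** Sublinear rate in the smooth case:
`min_{0 ≤ i ≤ N−1} ‖∇f(x_i)‖ ≤ (β̄ u_g + 1) √((f(x₀) − f_low)/M) / √|S|`,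
where `M = c · min{β̄ κ/u_p, 2τκ²(1−c)/(2 u_g u_p + L)}`. -/
theorem full_low_eval_sublinear_rate {n : ℕ}
    (f : EuclideanSpace ℝ (Fin n) → ℝ) (L : ℝ) (hL : 0 < L)
    (hdiff : Differentiable ℝ f)
    (hlip : ∀ y z : EuclideanSpace ℝ (Fin n),
      ‖gradient f y - gradient f z‖ ≤ L * ‖y - z‖)
    (f_low : ℝ) (hflow : ∀ y, f_low ≤ f y)
    (c τ βbar u_g u_p κ : ℝ)
    (hc : 0 < c) (hc1 : c < 1) (hτ : 0 < τ) (hτ1 : τ < 1)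
    (hβbar : 0 < βbar) (hug : 0 < u_g) (hup : 0 < u_p) (hκ : 0 < κ)
    (N : ℕ) (hN : 1 ≤ N)
    (x : ℕ → EuclideanSpace ℝ (Fin n))
    (S : Finset ℕ) (hSsub : S ⊆ Finset.range N) (hSne : S.Nonempty)
    (hsucc : ∀ i ∈ S, ∃ (β : ℝ) (g p : EuclideanSpace ℝ (Fin n)),
      0 < β ∧ β ≤ βbar ∧ p ≠ 0 ∧
      x (i + 1) = x i + β • p ∧
      ‖gradient f (x i) - g‖ ≤ u_g * β * ‖g‖ ∧
      ⟪-g, p⟫ > κ * (‖g‖ * ‖p‖) ∧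
      ‖g‖ ≤ u_p * ‖p‖ ∧
      f (x i + β • p) ≤ f (x i) + c * β * ⟪g, p⟫ ∧
      (β = βbar ∨ f (x i + (β / τ) • p) - f (x i) > c * (β / τ) * ⟪g, p⟫))
    (hother : ∀ i, i < N → i ∉ S → f (x (i + 1)) ≤ f (x i)) :
    (Finset.range N).inf'
        (Finset.nonempty_range_iff.mpr (Nat.one_le_iff_ne_zero.mp hN))
        (fun i => ‖gradient f (x i)‖) ≤
      (βbar * u_g + 1) *
        Real.sqrt ((f (x 0) - f_low) /
          (c * min (βbar * κ / u_p) (2 * τ * κ ^ 2 * (1 - c) / (2 * u_g * u_p + L)))) *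
        (1 / Real.sqrt (S.card : ℝ)) := by
  set M := c * min (βbar * κ / u_p) (2 * τ * κ ^ 2 * (1 - c) / (2 * u_g * u_p + L)) with hM
  have h1c : 0 < 1 - c := by linarith
  have hMpos : 0 < M := by positivity
  have hA : 0 < βbar * u_g + 1 := by positivity
  set m := (Finset.range N).inf'
        (Finset.nonempty_range_iff.mpr (Nat.one_le_iff_ne_zero.mp hN))
        (fun i => ‖gradient f (x i)‖) with hm
  have hm0 : 0 ≤ m := Finset.le_inf' _ _ (fun i _ => norm_nonneg _)
  have key : ∀ i ∈ S, M * (m / (βbar * u_g + 1)) ^ 2 ≤ f (x i) - f (x (i + 1)) := by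
    intro i hi
    obtain ⟨β, g, p, hβ, hββ, hp, hx, hg, hgp, hgup, hdec, hor⟩ := hsucc i hi
    have hmi : m ≤ ‖gradient f (x i)‖ := Finset.inf'_le _ (hSsub hi)
    have hgn := norm_nonneg g
    have hpn : 0 < ‖p‖ := norm_pos_iff.mpr hp
    rw [inner_neg_left] at hgp
    have hmg : m / (βbar * u_g + 1) ≤ ‖g‖ := by
      rw [div_le_iff₀ hA]
      have h1 := norm_le_norm_add_norm_sub' (gradient f (x i)) g
      have h2 : u_g * β * ‖g‖ ≤ u_g * βbar * ‖g‖ := by gcongr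
      nlinarith
    have hsq : (m / (βbar * u_g + 1)) ^ 2 ≤ ‖g‖ ^ 2 := by gcongr
    have hstep : min (βbar * κ / u_p) (2 * τ * κ ^ 2 * (1 - c) / (2 * u_g * u_p + L)) * ‖g‖ ^ 2
        ≤ β * (κ * (‖g‖ * ‖p‖)) := by
      rcases hor with h | h
      · refine (mul_le_mul_of_nonneg_right (min_le_left _ _) (sq_nonneg _)).trans ?_
        rw [h, div_mul_eq_mul_div, div_le_iff₀ hup]
        have : βbar * κ * ‖g‖ * ‖g‖ ≤ βbar * κ * ‖g‖ * (u_p * ‖p‖) := by gcongr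
        nlinarith
      · refine (mul_le_mul_of_nonneg_right (min_le_right _ _) (sq_nonneg _)).trans ?_
        have hD : 0 < 2 * u_g * u_p + L := by positivity
        have hs : 0 < β / τ := by positivity
        have hds := descent_aux f L hdiff hlip (x i) ((β / τ) • p)
        rw [inner_smul_right, norm_smul, Real.norm_of_nonneg hs.le] at hds
        have hin := real_inner_le_norm (gradient f (x i) - g) p
        rw [inner_sub_left] at hin
        have hin2 := mul_le_mul_of_nonneg_right hg hpn.le
        have h3 : u_g * β * ‖g‖ * ‖p‖ ≤ u_g * (β / τ) * (u_p * ‖p‖) * ‖p‖ := by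
          have : β ≤ β / τ := by rw [le_div_iff₀ hτ]; nlinarith
          gcongr
        set s := β / τ with hsdef
        have hβs : β = τ * s := by rw [hsdef]; field_simp
        have h4 : s * (c * ⟪g, p⟫) < s * (⟪gradient f (x i), p⟫ + L / 2 * s * ‖p‖ ^ 2) := by
          nlinarith
        have h5 := lt_of_mul_lt_mul_left h4 hs.le
        have h6 : (1 - c) * (κ * (‖g‖ * ‖p‖)) ≤ (1 - c) * (-⟪g, p⟫) := by gcongr
        have h7 : (2 * (1 - c) * κ * ‖g‖) * ‖p‖ ≤ (s * ‖p‖ * (2 * u_g * u_p + L)) * ‖p‖ := by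
          nlinarith
        have h8 := le_of_mul_le_mul_right h7 hpn
        have h9 := mul_le_mul_of_nonneg_left h8 (by positivity : 0 ≤ τ * κ * ‖g‖)
        rw [div_mul_eq_mul_div, div_le_iff₀ hD, hβs]
        nlinarith
    rw [hx]
    have h1 : M * (m / (βbar * u_g + 1)) ^ 2 ≤ M * ‖g‖ ^ 2 := by gcongr
    have h2 := mul_le_mul_of_nonneg_left hstep hc.le
    have h3 := mul_le_mul_of_nonneg_left hgp.le (by positivity : 0 ≤ c * β)
    rw [← mul_assoc, ← hM] at h2
    linarith
  set D := M * (m / (βbar * u_g + 1)) ^ 2 with hDdef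
  have tel : ∀ k ≤ N, ((S ∩ Finset.range k).card : ℝ) * D ≤ f (x 0) - f (x k) := by
    intro k
    induction k with
    | zero => simp
    | succ k ih =>
      intro hk
      have ih := ih (by omega)
      by_cases hkS : k ∈ S
      · rw [Finset.range_add_one, Finset.inter_insert_of_mem hkS,
          Finset.card_insert_of_notMem (by simp)]
        have := key k hkS
        push_cast
        linarith
      · rw [Finset.range_add_one, Finset.inter_insert_of_notMem hkS]
        have := hother k (by omega) hkS
        linarith
  have hfin := tel N le_rfl
  rw [Finset.inter_eq_left.mpr hSsub] at hfin
  have hcard : (0 : ℝ) < S.card := by exact_mod_cast hSne.card_pos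
  have hlow := hflow (x N)
  have h1 : (m / (βbar * u_g + 1)) ^ 2 ≤ (f (x 0) - f_low) / M / S.card := by
    rw [le_div_iff₀ hcard, le_div_iff₀ hMpos]
    rw [hDdef] at hfin
    linarith
  have h2 := Real.le_sqrt_of_sq_le h1
  rw [Real.sqrt_div' _ hcard.le, div_le_iff₀ hA] at h2
  refine h2.trans (le_of_eq ?_)
  ring
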